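/- For every natural number n, the identity A_{n+1}(X) = (1/(n+2))·( (X + i)^{n+2} − i^{n+2} − ∑_{k=0}^{n} binom(n+2, k)·(2i)^{n+1−k}·A_k(X) ) holds in ℂ[X], where binom denotes the binomial coefficient. -/

import Mathlib

open Polynomial Finset

/-- The pair of polynomial sequences (Aₙ, Cₙ) from the paper:
A₀ = X, C₀ = 0, and
A_{n+1} = ((n+1)/(n+2))·(X·Aₙ + ∑_{k=0}^{n} λₙᵏ·A_k),
C_{n+1} = ((n+1)/(n+2))·((X²+1)·Xⁿ + ∑_{k=0}^{n} λₙᵏ·C_k),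
where λₙᵏ is the coefficient of Xᵏ in Cₙ. -/
noncomputable def AC : ℕ → Polynomial ℂ × Polynomial ℂ
  | 0 => (Polynomial.X, 0)
  | (n+1) =>
    (((n+1 : ℂ)/(n+2)) • (Polynomial.X * (AC n).1 +
        ∑ k ∈ (Finset.range (n+1)).attach, ((AC n).2.coeff k) • (AC k).1),
     ((n+1 : ℂ)/(n+2)) • ((Polynomial.X^2 + 1) * Polynomial.X^n +
        ∑ k ∈ (Finset.range (n+1)).attach, ((AC n).2.coeff k) • (AC k).2))
  decreasing_by
  all_goals first
    | exact Nat.lt_succ_self n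
    | exact Nat.lt_succ_of_lt (Finset.mem_range.mp k.2)
    | exact Finset.mem_range.mp k.2

noncomputable def polyA (n : ℕ) : Polynomial ℂ := (AC n).1
noncomputable def polyC (n : ℕ) : Polynomial ℂ := (AC n).2


lemma polyA_zero : polyA 0 = X := by simp [polyA, AC]
lemma polyC_zero : polyC 0 = 0 := by simp [polyC, AC]

lemma polyA_succ (n : ℕ) : polyA (n+1) = C ((n+1 : ℂ)/(n+2)) * (X * polyA n +
    ∑ k ∈ range (n+1), C ((polyC n).coeff k) * polyA k) := by
  rw [polyA, AC]
  simp only [← smul_eq_C_mul]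
  rw [Finset.sum_attach (range (n+1)) (fun k => ((AC n).2.coeff k) • (AC k).1)]
  rfl

lemma polyC_succ (n : ℕ) : polyC (n+1) = C ((n+1 : ℂ)/(n+2)) * ((X^2 + 1) * X^n +
    ∑ k ∈ range (n+1), C ((polyC n).coeff k) * polyC k) := by
  rw [polyC, AC]
  simp only [← smul_eq_C_mul]
  rw [Finset.sum_attach (range (n+1)) (fun k => ((AC n).2.coeff k) • (AC k).2)]
  rfl

lemma polyC_deg (n : ℕ) : (∀ j, n + 1 < j → (polyC n).coeff j = 0) ∧
    (polyC n).coeff (n+1) = (n : ℂ)/(n+1) := by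
  induction n using Nat.strong_induction_on with
  | _ n ih =>
    cases n with
    | zero => simp [polyC_zero]
    | succ n =>
      have hs : ∀ j, n + 1 < j →
          (∑ k ∈ range (n+1), C ((polyC n).coeff k) * polyC k).coeff j = 0 := by
        intro j hj
        rw [finsetSum_coeff]
        apply Finset.sum_eq_zero
        intro k hk
        have hk' := Finset.mem_range.mp hk
        rw [coeff_C_mul, (ih k hk').1 j (by omega), mul_zero]
      have e : ((X:ℂ[X])^2 + 1) * X^n = X^(n+2) + X^n := by ring
      constructor
      · intro j hj
        rw [polyC_succ, coeff_C_mul, coeff_add, hs j (by omega), e, coeff_add, coeff_X_pow,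
          coeff_X_pow, if_neg (by omega), if_neg (by omega)]
        simp
      · rw [polyC_succ, coeff_C_mul, coeff_add, hs _ (by omega), e, coeff_add, coeff_X_pow,
          coeff_X_pow, if_pos (by omega), if_neg (by omega)]
        push_cast
        ring

lemma polyC_trunc (n : ℕ) : polyC n = ∑ k ∈ range (n+1), C ((polyC n).coeff k) * X^k
    + C ((n : ℂ)/(n+1)) * X^(n+1) := by
  have h : (polyC n).natDegree < n + 2 := by
    have : (polyC n).natDegree ≤ n + 1 :=
      natDegree_le_iff_coeff_eq_zero.mpr (fun j hj => (polyC_deg n).1 j hj)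
    omega
  refine (as_sum_range_C_mul_X_pow' _ h).trans ?_
  rw [sum_range_succ, (polyC_deg n).2]

/-- shift up, shift down -/
noncomputable def shU (p : ℂ[X]) : ℂ[X] := p.comp (X + C Complex.I)
noncomputable def shD (p : ℂ[X]) : ℂ[X] := p.comp (X - C Complex.I)

lemma CI_sq : (C Complex.I : ℂ[X])^2 = -1 := by
  rw [← C_pow, Complex.I_sq]; simp

lemma shU_sum (n : ℕ) (f : ℕ → ℂ) (p : ℕ → ℂ[X]) :
    shU (∑ k ∈ range n, C (f k) * p k) = ∑ k ∈ range n, C (f k) * shU (p k) := by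
  simp [shU]
lemma shD_sum (n : ℕ) (f : ℕ → ℂ) (p : ℕ → ℂ[X]) :
    shD (∑ k ∈ range n, C (f k) * p k) = ∑ k ∈ range n, C (f k) * shD (p k) := by
  simp [shD]

lemma key (n : ℕ) : shU (polyA n) - shD (polyA n) = 2 * C Complex.I * X^n ∧
    (polyA n).eval 0 = 0 ∧
    2 * polyC n = 2 * X^(n+1) - (shU (polyA n) + shD (polyA n)) := by
  induction n using Nat.strong_induction_on with
  | _ n ih =>
    cases n with
    | zero =>
      refine ⟨?_, ?_, ?_⟩ <;> simp [polyA_zero, polyC_zero, shU, shD] <;> ring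
    | succ n =>
      obtain ⟨h1, h2, h3⟩ := ih n (by omega)
      have hT := polyC_trunc n
      set S := ∑ k ∈ range (n+1), C ((polyC n).coeff k) * polyA k with hS
      set T := ∑ k ∈ range (n+1), C ((polyC n).coeff k) * X^k with hTdef
      have hn1 : (n + 1 : ℂ) ≠ 0 := by exact_mod_cast Nat.succ_ne_zero n
      have hn2 : (n + 2 : ℂ) ≠ 0 := by exact_mod_cast Nat.succ_ne_zero (n+1)
      have hSd : shU S - shD S = 2 * C Complex.I * T := by
        rw [hS, shU_sum, shD_sum, ← sum_sub_distrib, hTdef, mul_sum]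
        apply sum_congr rfl
        intro k hk
        rw [← mul_sub, (ih k (mem_range.mp hk)).1]; ring
      have hSc : 2 * ∑ k ∈ range (n+1), C ((polyC n).coeff k) * polyC k
          = 2 * X * T - (shU S + shD S) := by
        rw [hS, shU_sum, shD_sum, ← sum_add_distrib, hTdef, mul_sum, mul_sum, ← sum_sub_distrib]
        apply sum_congr rfl
        intro k hk
        linear_combination C ((polyC n).coeff k) * (ih k (mem_range.mp hk)).2.2
      have hU : shU (polyA (n+1)) = C ((n+1 : ℂ)/(n+2)) *
          ((X + C Complex.I) * shU (polyA n) + shU S) := by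
        rw [polyA_succ, ← hS]; simp only [shU, Polynomial.mul_comp, Polynomial.add_comp, C_comp, X_comp]
      have hD : shD (polyA (n+1)) = C ((n+1 : ℂ)/(n+2)) *
          ((X - C Complex.I) * shD (polyA n) + shD S) := by
        rw [polyA_succ, ← hS]; simp only [shD, Polynomial.mul_comp, Polynomial.add_comp, C_comp, X_comp]
      have hc : C ((n+1 : ℂ)/(n+2)) * (2 - C ((n : ℂ)/(n+1))) = 1 := by
        have : (2 : ℂ[X]) = C 2 := (map_ofNat C 2).symm
        rw [this, ← C_sub, ← C_mul, ← C_1]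
        congr 1
        field_simp
        ring
      refine ⟨?_, ?_, ?_⟩
      · rw [hU, hD]
        linear_combination C ((n+1 : ℂ)/(n+2)) * (hSd + X * h1 - 2 * C Complex.I * hT
          + C Complex.I * h3) + 2 * C Complex.I * X^(n+1) * hc
      · rw [polyA_succ, eval_mul, eval_add, eval_mul, eval_finsetSum, sum_eq_zero]
        · simp
        · intro k hk
          rw [eval_mul, (ih k (mem_range.mp hk)).2.1, mul_zero]
      · rw [hU, hD, polyC_succ]
        linear_combination C ((n+1 : ℂ)/(n+2)) * (hSc + X * h3 - 2 * X * hT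
          + C Complex.I * h1 + 2 * X^n * CI_sq) + 2 * X^(n+2) * hc

lemma sh_inj (p : ℂ[X]) (h : shU p = shD p) (h0 : p.eval 0 = 0) : p = 0 := by
  have hr : ∀ m : ℕ, p.eval (2 * Complex.I * m) = 0 := by
    intro m
    induction m with
    | zero => simpa using h0
    | succ m ih =>
      have := congrArg (eval (2 * Complex.I * m + Complex.I)) h
      simp only [shU, shD, eval_comp, eval_add, eval_sub, eval_X, eval_C] at this
      rw [add_sub_cancel_right, ih] at this
      rw [← this]
      congr 1
      push_cast
      ring
  apply eq_zero_of_infinite_isRoot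
  apply Set.infinite_of_injective_forall_mem (f := fun m : ℕ => 2 * Complex.I * (m : ℂ)) _ hr
  intro a b hab
  simpa using hab

theorem stmt17 (n : ℕ) :
    polyA (n + 1) =
      ((1 : ℂ) / (n + 2)) •
        ((Polynomial.X + Polynomial.C Complex.I) ^ (n + 2) -
          Polynomial.C (Complex.I ^ (n + 2)) -
          ∑ k ∈ Finset.range (n + 1),
            (((n + 2).choose k : ℂ) * (2 * Complex.I) ^ (n + 1 - k)) • polyA k) := by
  have hn2 : (n + 2 : ℂ) ≠ 0 := by exact_mod_cast Nat.succ_ne_zero (n+1)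
  have main : ∑ k ∈ range (n+2), C (((n + 2).choose k : ℂ) * (2 * Complex.I) ^ (n + 1 - k)) * polyA k
      - ((X + C Complex.I) ^ (n + 2) - C (Complex.I ^ (n + 2))) = 0 := by
    apply sh_inj
    · rw [← sub_eq_zero]
      have e1 : ∀ p q : ℂ[X], shU (p - q) = shU p - shU q := fun p q => by simp [shU]
      have e2 : ∀ p q : ℂ[X], shD (p - q) = shD p - shD q := fun p q => by simp [shD]
      rw [e1, e2, e1, e2, shU_sum, shD_sum]
      have hs : ∑ k ∈ range (n+2), C (((n + 2).choose k : ℂ) * (2 * Complex.I) ^ (n + 1 - k)) * shU (polyA k)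
        - ∑ k ∈ range (n+2), C (((n + 2).choose k : ℂ) * (2 * Complex.I) ^ (n + 1 - k)) * shD (polyA k)
        = (X + 2 * C Complex.I)^(n+2) - X^(n+2) := by
        rw [← sum_sub_distrib, add_pow, sum_range_succ _ (n+2)]
        simp only [Nat.sub_self, pow_zero, Nat.choose_self, Nat.cast_one, mul_one,
          add_sub_cancel_right]
        apply sum_congr rfl
        intro k hk
        have hk' := mem_range.mp hk
        rw [← mul_sub, (key k).1, show n + 2 - k = (n + 1 - k) + 1 by omega, pow_succ]
        simp only [C_mul, C_pow, map_natCast, map_ofNat]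
        ring
      have hx : shU ((X + C Complex.I)^(n+2)) = (X + 2 * C Complex.I)^(n+2) := by
        simp only [shU, pow_comp, add_comp, X_comp, C_comp]; ring
      have hy : shD ((X + C Complex.I)^(n+2)) = X^(n+2) := by
        simp only [shD, pow_comp, add_comp, X_comp, C_comp]; ring
      have hz : shU (C (Complex.I^(n+2))) = shD (C (Complex.I^(n+2))) := by
        simp only [shU, shD, C_comp]
      rw [hx, hy, hz]
      linear_combination hs
    · rw [eval_sub, eval_finsetSum, sum_eq_zero]
      · simp
      · intro k _
        rw [eval_mul, (key k).2.1, mul_zero]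
  rw [sum_range_succ] at main
  have hch : (n+2).choose (n+1) = n + 2 := Nat.choose_succ_self_right (n+1)
  rw [hch, Nat.sub_self, pow_zero, mul_one] at main
  simp only [smul_eq_C_mul] at *
  have hc : C ((1:ℂ)/(n+2)) * C (((n+2 : ℕ) : ℂ)) = 1 := by
    rw [← C_mul, ← C_1]
    congr 1
    push_cast
    field_simp
  linear_combination C ((1:ℂ)/(n+2)) * main - polyA (n+1) * hc
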